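/- The number of n-by-n alternating-sign matrices equals the product ∏_{k=0}^{n-1} (3k+1)!/(n+k)!. -/

import Mathlib

/-- An alternating-sign matrix of order `n`: entries in `{-1,0,1}`, all partial sums of
each row and each column (from the start) are `0` or `1`, and every row and column sums
to `1`.  This is equivalent to the condition that in each row and column the nonzero
entries alternate in sign, beginning and ending with `+1`. -/
def IsASM {n : ℕ} (A : Matrix (Fin n) (Fin n) ℤ) : Prop :=
  (∀ i j, A i j = -1 ∨ A i j = 0 ∨ A i j = 1) ∧
  (∀ i j, ∑ j' ∈ Finset.univ.filter (fun j' => j' ≤ j), A i j' = 0 ∨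
          ∑ j' ∈ Finset.univ.filter (fun j' => j' ≤ j), A i j' = 1) ∧
  (∀ i j, ∑ i' ∈ Finset.univ.filter (fun i' => i' ≤ i), A i' j = 0 ∨
          ∑ i' ∈ Finset.univ.filter (fun i' => i' ≤ i), A i' j = 1) ∧
  (∀ i, ∑ j, A i j = 1) ∧
  (∀ j, ∑ i, A i j = 1)


/-! Part 1: the six-vertex row operators and the Yang-Baxter equation -/
noncomputable section ASMProof

/-- weight of type a -/
def wA (w x y : ℂ) : ℂ := w * x - w ^ 2 * y
/-- weight of type b -/
def wB (w x y : ℂ) : ℂ := w * y - w ^ 2 * x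
/-- weight of type c -/
def wC (w x : ℂ) : ℂ := (w - w ^ 2) * x

/-- Row operator with spectral parameter `x`, column parameters `ys`, entering horizontal
state `h` and leaving horizontal state `true`. -/
def rowOp (w x : ℂ) : List ℂ → Bool → (List Bool → ℂ) → List Bool → ℂ
  | [], true, f, _ => f []
  | [], false, _, _ => 0
  | _ :: _, _, _, [] => 0
  | y :: ys, false, f, false :: s =>
      wA w x y * rowOp w x ys false (fun t => f (false :: t)) s
        + wC w x * rowOp w x ys true (fun t => f (true :: t)) s
  | y :: ys, true, f, false :: s =>
      wB w x y * rowOp w x ys true (fun t => f (false :: t)) s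
  | y :: ys, false, f, true :: s =>
      wB w x y * rowOp w x ys false (fun t => f (true :: t)) s
  | y :: ys, true, f, true :: s =>
      wA w x y * rowOp w x ys true (fun t => f (true :: t)) s
        + wC w y * rowOp w x ys false (fun t => f (false :: t)) s

theorem rowOp_add (w x : ℂ) (ys : List ℂ) : ∀ (h : Bool) (f g : List Bool → ℂ) (s : List Bool),
    rowOp w x ys h (fun t => f t + g t) s = rowOp w x ys h f s + rowOp w x ys h g s := by
  induction ys with
  | nil => intro h f g s; cases h <;> simp [rowOp]
  | cons y ys ih =>
    intro h f g s
    rcases s with _ | ⟨b, s⟩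
    · simp [rowOp]
    · cases h <;> cases b <;> simp only [rowOp, ih] <;> ring

theorem rowOp_smul (w x : ℂ) (ys : List ℂ) : ∀ (h : Bool) (c : ℂ) (f : List Bool → ℂ) (s : List Bool),
    rowOp w x ys h (fun t => c * f t) s = c * rowOp w x ys h f s := by
  induction ys with
  | nil => intro h c f s; cases h <;> simp [rowOp]
  | cons y ys ih =>
    intro h c f s
    rcases s with _ | ⟨b, s⟩
    · simp [rowOp]
    · cases h <;> cases b <;> simp only [rowOp, ih] <;> ring

theorem rowOp_yb (w x x' : ℂ) (hw : w ^ 2 + w + 1 = 0) (hd : w ^ 2 * x' - w * x ≠ 0) (ys : List ℂ) :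
    ∀ (f : List Bool → ℂ) (s : List Bool),
    rowOp w x ys false (rowOp w x' ys false f) s = rowOp w x' ys false (rowOp w x ys false f) s ∧
    rowOp w x ys true (rowOp w x' ys true f) s = rowOp w x' ys true (rowOp w x ys true f) s ∧
    (w ^ 2 * x' - w * x) * rowOp w x' ys false (rowOp w x ys true f) s =
      (w ^ 2 - w) * x' * rowOp w x ys false (rowOp w x' ys true f) s
       + (x - x') * rowOp w x ys true (rowOp w x' ys false f) s ∧
    (w ^ 2 * x' - w * x) * rowOp w x' ys true (rowOp w x ys false f) s =
      (x - x') * rowOp w x ys false (rowOp w x' ys true f) s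
       + (w ^ 2 - w) * x * rowOp w x ys true (rowOp w x' ys false f) s := by
  induction ys with
  | nil => intro f s; simp [rowOp]
  | cons y ys ih =>
    intro f s
    rcases s with _ | ⟨b, s⟩
    · simp [rowOp]
    · obtain ⟨f1, f2, f3, f4⟩ := ih (fun t => f (false :: t)) s
      obtain ⟨t1, t2, t3, t4⟩ := ih (fun t => f (true :: t)) s
      have h2 : w ^ 2 = -1 - w := by linear_combination hw
      have hlam : ∀ b : Bool, ∃ F : Bool → Bool → ℂ, ∃ G : Bool → Bool → ℂ,
          (∀ h h', rowOp w x ys h (rowOp w x' ys h' (fun t => f (b :: t))) s = F h h') ∧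
          (∀ h h', rowOp w x' ys h (rowOp w x ys h' (fun t => f (b :: t))) s = G h h') :=
        fun b => ⟨_, _, fun _ _ => rfl, fun _ _ => rfl⟩
      obtain ⟨F, G, hF, hG⟩ := hlam false
      obtain ⟨F', G', hF', hG'⟩ := hlam true
      simp only [hF, hG, hF', hG'] at f1 f2 f3 f4 t1 t2 t3 t4
      cases b
      · simp only [rowOp, rowOp_add, rowOp_smul, hF, hG, hF', hG', wA, wB, wC]
        clear hF hG hF' hG' ih
        refine ⟨?_, ?_, ?_, ?_⟩
        · apply mul_left_cancel₀ hd
          linear_combination (norm := skip) (w ^ 2 * x' - w * x) * (w * x - w ^ 2 * y) * (w * x' - w ^ 2 * y) * f1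
            - (w * x' - w ^ 2 * y) * (w - w ^ 2) * x * t3 - (w * y - w ^ 2 * x) * (w - w ^ 2) * x' * t4
          clear hd f1 f2 f3 f4 t1 t2 t3 t4
          grind
        · linear_combination (w * y - w ^ 2 * x) * (w * y - w ^ 2 * x') * f2
        · linear_combination (norm := skip) (w * x' - w ^ 2 * y) * (w * y - w ^ 2 * x) * f3 
            + (w - w ^ 2) * x' * (w - w ^ 2) * y * f4 - (w ^ 2 * x' - w * x) * (w - w ^ 2) * x' * (w * x - w ^ 2 * y) * t2
          clear hd f1 f2 f3 f4 t1 t2 t3 t4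
          grind
        · linear_combination (norm := skip) (w * y - w ^ 2 * x') * (w * x - w ^ 2 * y) * f4
            - (w ^ 2 * x' - w * x) * (w - w ^ 2) * x * (w * y - w ^ 2 * x') * t2
          clear hd f1 f2 f3 f4 t1 t2 t3 t4
          grind
      · simp only [rowOp, rowOp_add, rowOp_smul, hF, hG, hF', hG', wA, wB, wC]
        clear hF hG hF' hG' ih
        refine ⟨?_, ?_, ?_, ?_⟩
        · linear_combination (w * y - w ^ 2 * x) * (w * y - w ^ 2 * x') * t1
        · apply mul_left_cancel₀ hd
          linear_combination (norm := skip) (w ^ 2 * x' - w * x) * (w * x - w ^ 2 * y) * (w * x' - w ^ 2 * y) * t2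
            - (w * x' - w ^ 2 * y) * (w - w ^ 2) * y * f4 - (w * y - w ^ 2 * x) * (w - w ^ 2) * y * f3
          clear hd f1 f2 f3 f4 t1 t2 t3 t4
          grind
        · linear_combination (norm := skip) (w * y - w ^ 2 * x') * (w * x - w ^ 2 * y) * t3
            - (w ^ 2 * x' - w * x) * (w - w ^ 2) * y * (w * y - w ^ 2 * x') * f1
          clear hd f1 f2 f3 f4 t1 t2 t3 t4
          grind
        · linear_combination (norm := skip) (w * x' - w ^ 2 * y) * (w * y - w ^ 2 * x) * t4
            + (w - w ^ 2) * x * (w - w ^ 2) * y * t3 - (w ^ 2 * x' - w * x) * (w - w ^ 2) * y * (w * x - w ^ 2 * y) * f1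
          clear hd f1 f2 f3 f4 t1 t2 t3 t4
          grind

/-- partition function with top boundary `s`, rows `xs`, columns `ys` -/
def pf (w : ℂ) (ys : List ℂ) : List ℂ → List Bool → ℂ
  | [], s => if s.all id then 1 else 0
  | x :: xs, s => rowOp w x ys false (pf w ys xs) s

theorem pf_perm (w : ℂ) (hw : w ^ 2 + w + 1 = 0) (ys : List ℂ) {xs xs' : List ℂ} (h : xs.Perm xs')
    (hx : ∀ x ∈ xs, ∀ x' ∈ xs, w ^ 2 * x' - w * x ≠ 0) : pf w ys xs = pf w ys xs' := by
  induction h with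
  | nil => rfl
  | cons x h ih =>
    have := ih (fun a ha b hb => hx a (List.mem_cons_of_mem _ ha) b (List.mem_cons_of_mem _ hb))
    funext s; simp only [pf, this]
  | swap x y l =>
    funext s
    exact (rowOp_yb w y x hw (hx _ (by simp) _ (by simp)) ys _ s).1
  | trans h1 h2 ih1 ih2 =>
    rw [ih1 hx, ih2]
    intro a ha b hb
    exact hx a (h1.mem_iff.2 ha) b (h1.mem_iff.2 hb)

theorem pf_true (w y : ℂ) (ys : List ℂ) : ∀ (xs : List ℂ) (s : List Bool),
    pf w (y :: ys) xs (true :: s) = (xs.map (fun x => wB w x y)).prod * pf w ys xs s := by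
  intro xs
  induction xs with
  | nil => intro s; simp [pf]
  | cons x xs ih =>
    intro s
    simp only [pf, rowOp, ih, rowOp_smul, List.map_cons, List.prod_cons]
    ring

theorem rowOp_frozen (w x : ℂ) : ∀ (ys : List ℂ) (f : List Bool → ℂ),
    rowOp w x ys true f (List.replicate ys.length false) =
      (ys.map (fun y => wB w x y)).prod * f (List.replicate ys.length false) := by
  intro ys
  induction ys with
  | nil => intro f; simp [rowOp]
  | cons y ys ih =>
    intro f
    simp only [List.length_cons, List.replicate_succ, rowOp, ih, List.map_cons, List.prod_cons]
    ring

theorem pf_frozen (w x y : ℂ) (hxy : wA w x y = 0) (xs ys : List ℂ) :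
    pf w (y :: ys) (x :: xs) (List.replicate (ys.length + 1) false) =
      wC w x * (ys.map (fun y => wB w x y)).prod * (xs.map (fun x => wB w x y)).prod *
        pf w ys xs (List.replicate ys.length false) := by
  simp only [pf, List.replicate_succ, rowOp, hxy, rowOp_frozen, pf_true]
  ring

/-- functions given by polynomials of degree less than `N` -/
def IsP (N : ℕ) (g : ℂ → ℂ) : Prop := ∃ p : Polynomial ℂ, p.degree < N ∧ ∀ u, g u = p.eval u

theorem IsP.add {N : ℕ} {f g : ℂ → ℂ} (hf : IsP N f) (hg : IsP N g) : IsP N (fun u => f u + g u) := by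
  obtain ⟨p, hp, hp'⟩ := hf
  obtain ⟨q, hq, hq'⟩ := hg
  exact ⟨p + q, lt_of_le_of_lt (Polynomial.degree_add_le _ _) (max_lt hp hq), by simp [hp', hq']⟩

theorem IsP.mono {N M : ℕ} (h : N ≤ M) {f : ℂ → ℂ} (hf : IsP N f) : IsP M f := by
  obtain ⟨p, hp, hp'⟩ := hf
  exact ⟨p, lt_of_lt_of_le hp (by exact_mod_cast h), hp'⟩

theorem IsP.mul {N M : ℕ} {f g : ℂ → ℂ} (hf : IsP (N + 1) f) (hg : IsP M g) :
    IsP (N + M) (fun u => f u * g u) := by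
  obtain ⟨p, hp, hp'⟩ := hf
  obtain ⟨q, hq, hq'⟩ := hg
  refine ⟨p * q, ?_, by simp [hp', hq']⟩
  rw [Polynomial.degree_lt_iff_coeff_zero] at *
  intro m hm
  rw [Polynomial.coeff_mul]
  apply Finset.sum_eq_zero
  rintro ⟨i, j⟩ hij
  rw [Finset.HasAntidiagonal.mem_antidiagonal] at hij
  simp only at hij
  by_cases h : N + 1 ≤ i
  · simp [hp i h]
  · simp [hq j (by omega)]

theorem IsP.const (c : ℂ) : IsP 1 (fun _ => c) :=
  ⟨Polynomial.C c, lt_of_le_of_lt Polynomial.degree_C_le (by norm_num), by simp⟩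

theorem IsP.zero (N : ℕ) : IsP N (fun _ => 0) :=
  ⟨0, by simp, by simp⟩

theorem IsP.cmul {N : ℕ} {f : ℂ → ℂ} (hf : IsP N f) (c : ℂ) : IsP N (fun u => c * f u) := by
  have := IsP.mul (N := 0) (IsP.const c) hf
  simpa using this

theorem IsP.pow (k : ℕ) : IsP (k + 1) (fun u => u ^ k) :=
  ⟨Polynomial.X ^ k, by rw [Polynomial.degree_X_pow]; exact_mod_cast Nat.lt_succ_self k, by simp⟩

theorem IsP.sum {ι : Type*} (s : Finset ι) {N : ℕ} {f : ι → ℂ → ℂ} (hf : ∀ i ∈ s, IsP N (f i)) :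
    IsP N (fun u => ∑ i ∈ s, f i u) := by
  classical
  induction s using Finset.induction_on with
  | empty => simpa using IsP.zero N
  | insert a s ha ih =>
    simp only [Finset.sum_insert ha]
    exact (hf a (by simp)).add (ih fun i hi => hf i (by simp [hi]))

theorem IsP.ext {N : ℕ} {f g : ℂ → ℂ} (hf : IsP N f) (hg : IsP N g) (s : Finset ℂ) (hs : N ≤ s.card)
    (h : ∀ u ∈ s, f u = g u) (u : ℂ) : f u = g u := by
  obtain ⟨p, hp, hp'⟩ := hf
  obtain ⟨q, hq, hq'⟩ := hg
  have hs' : (N : WithBot ℕ) ≤ s.card := by exact_mod_cast hs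
  have : p = q := Polynomial.eq_of_degrees_lt_of_eval_finset_eq s (hp.trans_le hs') (hq.trans_le hs')
    (fun x hx => by rw [← hp', ← hq', h x hx])
  rw [hp', hq', this]

theorem IsP.rowOp (w x : ℂ) (N : ℕ) (ys : List ℂ) : ∀ (h : Bool) (f : ℂ → List Bool → ℂ)
    (_ : ∀ t, IsP N (fun u => f u t)) (s : List Bool), IsP N (fun u => rowOp w x ys h (f u) s) := by
  induction ys with
  | nil =>
    intro h f hf s
    cases h
    · simpa [_root_.rowOp] using IsP.zero N
    · simpa [_root_.rowOp] using hf []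
  | cons y ys ih =>
    intro h f hf s
    have h1 := fun h s => ih h (fun u t => f u (false :: t)) (fun t => hf _) s
    have h2 := fun h s => ih h (fun u t => f u (true :: t)) (fun t => hf _) s
    rcases s with _ | ⟨b, s⟩
    · simpa [_root_.rowOp] using IsP.zero N
    · cases h <;> cases b <;> simp only [_root_.rowOp]
      · exact ((h1 _ _).cmul _).add ((h2 _ _).cmul _)
      · exact (h2 _ _).cmul _
      · exact (h1 _ _).cmul _
      · exact ((h2 _ _).cmul _).add ((h1 _ _).cmul _)

theorem IsP.lin (a b : ℂ) : IsP 2 (fun u => a * u + b) := by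
  have h1 : IsP 2 (fun u => a * u ^ 1) := (IsP.pow 1).cmul a
  have h2 : IsP 2 (fun _ => b) := (IsP.const b).mono (by norm_num)
  simpa using h1.add h2

theorem IsP.prodB (w : ℂ) (xs : List ℂ) :
    IsP (xs.length + 1) (fun u => (xs.map (fun x => wB w x u)).prod) := by
  induction xs with
  | nil => simpa using IsP.const 1
  | cons x xs ih =>
    have := (IsP.lin w (- (w ^ 2 * x))).mul ih
    simp only [List.map_cons, List.prod_cons, List.length_cons]
    refine IsP.mono (by omega : 1 + (xs.length + 1) ≤ _) (by simpa [wB, sub_eq_add_neg] using this)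

theorem IsP.pf (w : ℂ) (ys : List ℂ) (xs : List ℂ) : ∀ s : List Bool,
    IsP xs.length (fun u => pf w (u :: ys) xs (false :: s)) := by
  induction xs with
  | nil => intro s; simpa [_root_.pf] using IsP.zero 0
  | cons x xs ih =>
    intro s
    simp only [_root_.pf, _root_.rowOp, List.length_cons]
    refine IsP.add ?_ ?_
    · have h1 := IsP.rowOp w x xs.length ys false (fun u t => _root_.pf w (u :: ys) xs (false :: t)) ih s
      have := (IsP.lin (-w ^ 2) (w * x)).mul h1
      refine IsP.mono (by omega : 1 + xs.length ≤ _) ?_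
      convert this using 3
      simp only [wA]; ring
    · apply IsP.cmul
      apply IsP.rowOp w x (xs.length + 1) ys true (fun u t => _root_.pf w (u :: ys) xs (true :: t))
      intro t
      simp only [pf_true]
      simpa [mul_comm] using (IsP.prodB w xs).cmul (_root_.pf w ys xs t)
end ASMProof

noncomputable section ASMProof2
open Matrix

/-- generalized Vandermonde determinant -/
def gd (N : ℕ) (e : ℕ → ℕ) (z : ℕ → ℂ) : ℂ :=
  Matrix.det (Matrix.of fun i j : Fin N => z i ^ e j)

/-- prepend to a sequence -/
def cn (u : ℂ) (z : ℕ → ℂ) : ℕ → ℂ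
  | 0 => u
  | k + 1 => z k

/-- exponents 0,1,3,4,6,7,... -/
def ex (j : ℕ) : ℕ := j + j / 2

theorem gd_poly (N M : ℕ) (e : ℕ → ℕ) (z : ℕ → ℂ) (he : ∀ j, j < N + 1 → e j ≤ M) :
    IsP (M + 1) (fun u => gd (N + 1) e (cn u z)) := by
  simp only [gd, Matrix.det_succ_row_zero]
  apply IsP.sum
  intro j _
  have h1 : IsP (M + 1) (fun u => u ^ e j) := (IsP.pow (e j)).mono (by have := he j j.2; omega)
  have h2 := h1.cmul ((-1) ^ (j : ℕ) * Matrix.det (Matrix.of fun a b : Fin N => z a ^ e (j.succAbove b)))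
  convert h2 using 2 with u
  simp only [Matrix.of_apply, cn, Fin.val_zero]
  rw [mul_right_comm]
  rfl

theorem gd_eq_zero (N : ℕ) (e : ℕ → ℕ) (z : ℕ → ℂ) (i j : ℕ) (hi : i < N) (hj : j < N) (hij : i ≠ j)
    (h : z i = z j) : gd N e z = 0 := by
  apply Matrix.det_zero_of_row_eq (i := ⟨i, hi⟩) (j := ⟨j, hj⟩) (by simpa using hij)
  funext k
  simp [h]

theorem gd_swap (N : ℕ) (z : ℕ → ℂ) (i j : ℕ) (hi : i < N) (hj : j < N) :
    ∃ ε : ℂ, ε ≠ 0 ∧ ∀ e, gd N e (z ∘ Equiv.swap i j) = ε * gd N e z := by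
  refine ⟨((Equiv.Perm.sign (Equiv.swap (⟨i, hi⟩ : Fin N) ⟨j, hj⟩) : ℤ) : ℂ), by simp, ?_⟩
  intro e
  rw [gd, gd, ← Matrix.det_permute]
  congr 1
  ext a b
  simp only [Matrix.of_apply, Matrix.submatrix_apply, id, Function.comp]
  congr 2
  simp only [Equiv.swap_apply_def, Fin.ext_iff]
  split_ifs <;> simp_all

theorem gd_id_succ (N : ℕ) (u : ℂ) (z : ℕ → ℂ) :
    gd (N + 1) id (cn u z) = (∏ k ∈ Finset.range N, (z k - u)) * gd N id z := by
  have h : ∀ N z, gd N id z = ∏ i : Fin N, ∏ j ∈ Finset.Ioi i, (z j - z i) := by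
    intro N z
    exact Matrix.det_vandermonde (fun i : Fin N => z i)
  rw [h, h, Fin.prod_univ_succ]
  simp only [Fin.prod_Ioi_zero, Fin.prod_Ioi_succ]
  rw [Finset.prod_range]
  rfl

theorem gd_ex_succ (N : ℕ) (u v : ℂ) (huv : v ^ 3 = u ^ 3) (z : ℕ → ℂ) :
    gd (N + 2) ex (cn u (cn v z)) =
      (v - u) * (∏ k ∈ Finset.range N, (z k ^ 3 - u ^ 3)) * gd N ex z := by
  set Z := cn u (cn v z) with hZ
  set M : Matrix (Fin (N + 2)) (Fin (N + 2)) ℂ := Matrix.of fun i j => Z i ^ ex j with hM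
  set S : Matrix (Fin (N + 2)) (Fin (N + 2)) ℂ :=
    Matrix.of fun i j => if (i : ℕ) + 2 = j then 1 else 0 with hS
  have hU : (1 - u ^ 3 • S).det = 1 := by
    rw [Matrix.det_of_upperTriangular]
    · apply Finset.prod_eq_one
      intro i _
      simp [hS]
    · intro i j hij
      have hij' : j < i := hij
      have h1 : ¬ ((i : ℕ) + 2 = j) := by have := Fin.lt_def.1 hij'; omega
      simp [hS, h1, Matrix.one_apply, hij'.ne']
  have hex : ∀ j, ex (j + 2) = ex j + 3 := by intro j; simp only [ex]; omega
  have e0 : ∀ i, (M * (1 - u ^ 3 • S)) i 0 = 1 := by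
    intro i
    rw [Matrix.mul_sub, Matrix.mul_smul, Matrix.sub_apply, Matrix.smul_apply, Matrix.mul_one,
      Matrix.mul_apply]
    simp [hS, hM, ex]
  have e1 : ∀ i, (M * (1 - u ^ 3 • S)) i 1 = Z i := by
    intro i
    rw [Matrix.mul_sub, Matrix.mul_smul, Matrix.sub_apply, Matrix.smul_apply, Matrix.mul_one,
      Matrix.mul_apply]
    simp [hS, hM, ex]
  have e2 : ∀ i (j : Fin N), (M * (1 - u ^ 3 • S)) i j.succ.succ = (Z i ^ 3 - u ^ 3) * Z i ^ ex j := by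
    intro i j
    rw [Matrix.mul_sub, Matrix.mul_smul, Matrix.sub_apply, Matrix.smul_apply, Matrix.mul_one,
      Matrix.mul_apply]
    rw [Finset.sum_eq_single (⟨j, by omega⟩ : Fin (N + 2))]
    · simp [hS, hM, hex]; ring
    · intro b _ hb
      have : ¬ ((b : ℕ) + 2 = j.succ.succ) := by
        intro h
        apply hb
        ext
        simpa using h
      simp only [hS, Matrix.of_apply, this, if_false, mul_zero]
    · simp
  have key : gd (N + 2) ex Z = (M * (1 - u ^ 3 • S)).det := by
    rw [Matrix.det_mul, hU, mul_one]; rfl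
  rw [key]
  set Q := M * (1 - u ^ 3 • S) with hQ
  have z0 : Z ((0 : Fin (N + 2)) : ℕ) = u := rfl
  have z1 : Z ((1 : Fin (N + 2)) : ℕ) = v := rfl
  rw [Matrix.det_succ_row_zero, Fin.sum_univ_succ, Fin.sum_univ_succ, Finset.sum_eq_zero (s := Finset.univ)]
  rotate_left
  · intro j _
    rw [e2, z0]; simp
  have hrest : ((Q.submatrix Fin.succ Fin.succ).submatrix Fin.succ Fin.succ).det =
      (∏ k ∈ Finset.range N, (z k ^ 3 - u ^ 3)) * gd N ex z := by
    rw [Finset.prod_range, gd, ← Matrix.det_mul_column]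
    congr 1
    ext i j
    simp only [Matrix.submatrix_apply, e2, Matrix.of_apply]
    rfl
  have hsub : ∀ (g : Fin (N + 1) → Fin (N + 2)) (hg : ∀ j : Fin N, g j.succ = j.succ.succ),
      (Q.submatrix Fin.succ g).det = Q 1 (g 0) *
        ((∏ k ∈ Finset.range N, (z k ^ 3 - u ^ 3)) * gd N ex z) := by
    intro g hg
    rw [Matrix.det_succ_row_zero, Fin.sum_univ_succ, Finset.sum_eq_zero (s := Finset.univ)]
    rotate_left
    · intro j _
      rw [Matrix.submatrix_apply, hg, e2]
      have : Z ((Fin.succ (0 : Fin (N + 1)) : Fin (N + 2)) : ℕ) = v := rfl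
      rw [this, huv]; simp
    rw [← hrest]
    simp only [Fin.val_zero, pow_zero, one_mul, add_zero, Matrix.submatrix_apply, Fin.succ_zero_eq_one]
    congr 2
    ext i j
    simp [hg]
  rw [hsub _ (by intro j; simp [Fin.succAbove]), hsub _ (by intro j; simp [Fin.succAbove, Fin.lt_def])]
  have a0 : (Fin.succAbove (0 : Fin (N + 2))) (0 : Fin (N + 1)) = 1 := by simp
  have a1 : (Fin.succAbove ((0 : Fin (N + 1)).succ)) (0 : Fin (N + 1)) = 0 := by
    simp [Fin.succAbove]
  rw [a0, a1, e0, e0, Fin.succ_zero_eq_one, e1, e1, z0, z1]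
  simp
  ring
end ASMProof2

noncomputable section ASMProof3

/-- interleaving y0,x0,y1,x1,... -/
def zz (x y : ℕ → ℂ) (k : ℕ) : ℂ := if k % 2 = 0 then y (k / 2) else x (k / 2)

/-- the constants -/
def kk (w : ℂ) : ℕ → ℂ
  | 0 => 1
  | n + 1 => (w - w ^ 2) * (-1) ^ n * kk w n

/-- the partition function with domain wall boundary -/
def pfn (w : ℂ) (n : ℕ) (x y : ℕ → ℂ) : ℂ :=
  pf w ((List.range n).map y) ((List.range n).map x) (List.replicate n false)

/-- the main identity -/
def MainEq (w : ℂ) (n : ℕ) (x y : ℕ → ℂ) : Prop :=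
  gd (2 * n) id (zz x y) * pfn w n x y =
    kk w n * (∏ i ∈ Finset.range n, x i) * gd (2 * n) ex (zz x y)

theorem range_map_succ (n : ℕ) (x : ℕ → ℂ) :
    (List.range (n + 1)).map x = x 0 :: (List.range n).map (fun k => x (k + 1)) := by
  rw [List.range_succ_eq_map, List.map_cons, List.map_map]; rfl

theorem zz_succ (x y : ℕ → ℂ) :
    zz x y = cn (y 0) (cn (x 0) (zz (fun k => x (k + 1)) (fun k => y (k + 1)))) := by
  funext k
  rcases k with _ | _ | k
  · rfl
  · rfl
  · simp only [zz, cn]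
    have h1 : (k + 1 + 1) % 2 = k % 2 := by omega
    have h2 : (k + 1 + 1) / 2 = k / 2 + 1 := by omega
    rw [h1, h2]

theorem prod_zz (n : ℕ) (x y : ℕ → ℂ) (f : ℂ → ℂ) :
    ∏ k ∈ Finset.range (2 * n), f (zz x y k) =
      (∏ k ∈ Finset.range n, f (x k)) * ∏ k ∈ Finset.range n, f (y k) := by
  induction n with
  | zero => simp
  | succ n ih =>
    rw [show 2 * (n + 1) = 2 * n + 1 + 1 by ring, Finset.prod_range_succ, Finset.prod_range_succ, ih,
      Finset.prod_range_succ, Finset.prod_range_succ]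
    have h1 : zz x y (2 * n) = y n := by simp [zz]
    have h2 : zz x y (2 * n + 1) = x n := by
      have h3 : (2 * n + 1) % 2 = 1 := by omega
      have h4 : (2 * n + 1) / 2 = n := by omega
      simp [zz, h3, h4]
    rw [h1, h2]; ring

theorem w_cube {w : ℂ} (hw : w ^ 2 + w + 1 = 0) : w ^ 3 = 1 := by
  linear_combination (w - 1) * hw

theorem mainEq_step (w : ℂ) (hw : w ^ 2 + w + 1 = 0) (n : ℕ) (x y : ℕ → ℂ) (hxy : x 0 = w * y 0)
    (ih : MainEq w n (fun k => x (k + 1)) (fun k => y (k + 1))) : MainEq w (n + 1) x y := by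
  have w3 := w_cube hw
  unfold MainEq at *
  set x' := fun k => x (k + 1) with hx'
  set y' := fun k => y (k + 1) with hy'
  set u := y 0 with hu
  have hA : wA w (x 0) u = 0 := by simp only [wA, hxy]; ring
  have hpf : pfn w (n + 1) x y = wC w (x 0) * (∏ k ∈ Finset.range n, wB w (x 0) (y' k)) *
      (∏ k ∈ Finset.range n, wB w (x' k) u) * pfn w n x' y' := by
    have := pf_frozen w (x 0) u hA ((List.range n).map x') ((List.range n).map y')
    simp only [List.length_map, List.length_range, List.map_map] at this
    rw [pfn, range_map_succ, range_map_succ, this]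
    rfl
  have hB1 : ∏ k ∈ Finset.range n, wB w (x 0) (y' k) =
      w ^ n * ∏ k ∈ Finset.range n, (y' k - w ^ 2 * u) := by
    rw [← Finset.card_range n, ← Finset.prod_const, Finset.card_range, ← Finset.prod_mul_distrib]
    apply Finset.prod_congr rfl
    intro k _
    simp only [wB, hxy]; ring
  have hB2 : ∏ k ∈ Finset.range n, wB w (x' k) u =
      (-w ^ 2) ^ n * ∏ k ∈ Finset.range n, (x' k - w ^ 2 * u) := by
    rw [← Finset.card_range n, ← Finset.prod_const, Finset.card_range, ← Finset.prod_mul_distrib]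
    apply Finset.prod_congr rfl
    intro k _
    simp only [wB]; linear_combination (-w * u) * w3
  have hpp := prod_zz n x' y' (fun z => z - w ^ 2 * u)
  have hsgn : w ^ n * (-w ^ 2) ^ n = (-1) ^ n := by
    rw [← mul_pow]; congr 1; linear_combination (-1) * w3
  have hcub : (∏ k ∈ Finset.range (2 * n), (zz x' y' k - u)) *
      (∏ k ∈ Finset.range (2 * n), (zz x' y' k - w * u)) *
      (∏ k ∈ Finset.range (2 * n), (zz x' y' k - w ^ 2 * u)) =
      ∏ k ∈ Finset.range (2 * n), (zz x' y' k ^ 3 - u ^ 3) := by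
    rw [← Finset.prod_mul_distrib, ← Finset.prod_mul_distrib]
    apply Finset.prod_congr rfl
    intro k _
    generalize zz x' y' k = z
    linear_combination (-z ^ 2 * u + w * z * u ^ 2) * hw + (- u ^ 3) * w3
  rw [zz_succ x y, show 2 * (n + 1) = 2 * n + 1 + 1 by ring, gd_id_succ, gd_id_succ,
    gd_ex_succ _ _ _ (by rw [hxy, mul_pow, w3, one_mul]), hpf, hB1, hB2, Finset.prod_range_succ]
  have hv : (∏ k ∈ Finset.range (2 * n), (cn (x 0) (zz x' y') k - u)) * (cn (x 0) (zz x' y') (2 * n) - u)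
      = (x 0 - u) * ∏ k ∈ Finset.range (2 * n), (zz x' y' k - u) := by
    rw [← Finset.prod_range_succ (fun k => cn (x 0) (zz x' y') k - u), Finset.prod_range_succ', mul_comm]
    rfl
  rw [hv, Finset.prod_range_succ' x, ← hx', ← hcub, hpp, kk, ← hsgn]
  simp only [wC]
  rw [hxy]
  generalize (∏ k ∈ Finset.range (2 * n), (zz x' y' k - w * u)) = P1
  generalize (∏ k ∈ Finset.range (2 * n), (zz x' y' k - u)) = P2
  generalize (∏ k ∈ Finset.range n, (x' k - w ^ 2 * u)) = P3
  generalize (∏ k ∈ Finset.range n, (y' k - w ^ 2 * u)) = P4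
  have : ∏ k ∈ Finset.range n, x (k + 1) = ∏ k ∈ Finset.range n, x' k := rfl
  rw [this]
  linear_combination (w * u - u) * P1 * P2 * P3 * P4 * (w - w ^ 2) * (w * u) * w ^ n * (-w ^ 2) ^ n * ih

theorem mainEq_swap (w : ℂ) (hw : w ^ 2 + w + 1 = 0) (n : ℕ) (x y : ℕ → ℂ) (i : ℕ) (hi : i < n + 1)
    (hx : ∀ a < n + 1, ∀ b < n + 1, w ^ 2 * x b - w * x a ≠ 0)
    (h : MainEq w (n + 1) (x ∘ Equiv.swap 0 i) y) : MainEq w (n + 1) x y := by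
  have hperm : ((List.range (n + 1)).map x).Perm ((List.range (n + 1)).map (x ∘ Equiv.swap 0 i)) := by
    rw [← List.map_map]
    apply List.Perm.map
    rw [List.perm_ext_iff_of_nodup List.nodup_range (List.nodup_range.map (Equiv.injective _))]
    intro a
    simp only [List.mem_range, List.mem_map]
    constructor
    · intro ha
      refine ⟨Equiv.swap 0 i a, ?_, by simp⟩
      rw [Equiv.swap_apply_def]; split_ifs <;> omega
    · rintro ⟨b, hb, rfl⟩
      rw [Equiv.swap_apply_def]; split_ifs <;> omega
  have hpf : pfn w (n + 1) (x ∘ Equiv.swap 0 i) y = pfn w (n + 1) x y := by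
    rw [pfn, pfn, pf_perm w hw _ hperm]
    intro a ha b hb
    simp only [List.mem_map, List.mem_range] at ha hb
    obtain ⟨a, ha, rfl⟩ := ha
    obtain ⟨b, hb, rfl⟩ := hb
    exact hx a ha b hb
  have hz : zz (x ∘ Equiv.swap 0 i) y = zz x y ∘ Equiv.swap 1 (2 * i + 1) := by
    funext k
    simp only [zz, Function.comp, Equiv.swap_apply_def]
    by_cases hk : k % 2 = 0
    · have h1 : k ≠ 1 := by omega
      have h2 : k ≠ 2 * i + 1 := by omega
      simp [hk, h1, h2]
    · by_cases h1 : k = 1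
      · subst h1
        have h4 : (2 * i + 1) / 2 = i := by omega
        simp [h4]
      · by_cases h2 : k = 2 * i + 1
        · subst h2
          have h4 : (2 * i + 1) / 2 = i := by omega
          have h5 : i ≠ 0 := by omega
          simp [h4, h5]
        · have h3 : k / 2 ≠ 0 := by omega
          have h4 : k / 2 ≠ i := by omega
          simp [h1, h2, h3, h4]
  have hprod : ∏ k ∈ Finset.range (n + 1), (x ∘ Equiv.swap 0 i) k = ∏ k ∈ Finset.range (n + 1), x k := by
    have := hperm.prod_eq
    simpa [Finset.prod, Finset.range, Multiset.range, Function.comp_def] using this.symm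
  obtain ⟨ε, hε, hg⟩ := gd_swap (2 * (n + 1)) (zz x y) 1 (2 * i + 1) (by omega) (by omega)
  unfold MainEq at *
  rw [hz, hg, hg, hpf, hprod] at h
  apply mul_left_cancel₀ hε
  linear_combination h

theorem cubes_ne {a b : ℂ} (h : a ^ 3 ≠ b ^ 3) : a ≠ b := by rintro rfl; exact h rfl

theorem mainEq (w : ℂ) (hw : w ^ 2 + w + 1 = 0) : ∀ (n : ℕ) (x y : ℕ → ℂ)
    (_ : ∀ a < 2 * n, zz x y a ≠ 0)
    (_ : ∀ a < 2 * n, ∀ b < 2 * n, a ≠ b → zz x y a ^ 3 ≠ zz x y b ^ 3), MainEq w n x y := by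
  have w3 := w_cube hw
  have w0 : w ≠ 0 := by rintro rfl; norm_num at w3
  have w1 : w ≠ 1 := by rintro rfl; norm_num at hw
  intro n
  induction n with
  | zero => intro x y _ _; simp [MainEq, pfn, pf, kk, gd]
  | succ n ih =>
    intro x y h0 h3
    have hzx : ∀ i, zz x y (2 * i + 1) = x i := by
      intro i
      have h3 : (2 * i + 1) % 2 = 1 := by omega
      have h4 : (2 * i + 1) / 2 = i := by omega
      simp [zz, h3, h4]
    have hzy : ∀ i, zz x y (2 * i) = y i := by intro i; simp [zz]
    have hx0 : ∀ i < n + 1, x i ≠ 0 := fun i hi => by rw [← hzx]; exact h0 _ (by omega)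
    have hxx : ∀ i < n + 1, ∀ j < n + 1, i ≠ j → x i ^ 3 ≠ x j ^ 3 := fun i hi j hj hij => by
      rw [← hzx, ← hzx]; exact h3 _ (by omega) _ (by omega) (by omega)
    have hd : ∀ a < n + 1, ∀ b < n + 1, w ^ 2 * x b - w * x a ≠ 0 := by
      intro a ha b hb h
      have h5 : w * x b = x a := mul_left_cancel₀ w0 (by linear_combination h)
      by_cases hab : a = b
      · subst hab
        have : (w - 1) * x a = 0 := by linear_combination h5
        rcases mul_eq_zero.1 this with h | h
        · exact w1 (by linear_combination h)
        · exact hx0 _ ha h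
      · apply hxx a ha b hb hab
        rw [← h5, mul_pow, w3, one_mul]
    set y' := fun k => y (k + 1) with hy'
    set r := fun k => zz x y (k + 1) with hr
    have hzz : ∀ u, zz x (cn u y') = cn u r := by
      intro u
      funext k
      rcases k with _ | k
      · rfl
      · simp only [cn, hr, zz]
        by_cases hk : (k + 1) % 2 = 0
        · obtain ⟨m, hm⟩ : ∃ m, (k + 1) / 2 = m + 1 := ⟨(k + 1) / 2 - 1, by omega⟩
          simp only [hk, hm, if_true]; rfl
        · simp [hk]
    have hcn : ∀ u k, cn u y' (k + 1) = y' k := fun u k => rfl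
    have hP1 : IsP (3 * n + 2) (fun u => gd (2 * (n + 1)) id (zz x (cn u y')) * pfn w (n + 1) x (cn u y')) := by
      have h1 := gd_poly (2 * n + 1) (2 * n + 1) id r (by intro j hj; simp; omega)
      have h2 := IsP.pf w ((List.range n).map y') ((List.range (n + 1)).map x) (List.replicate n false)
      have h3 := h1.mul h2
      simp only [List.length_map, List.length_range] at h3
      have h4 : 2 * n + 1 + (n + 1) = 3 * n + 2 := by ring
      rw [h4] at h3
      convert h3 using 3 with u
      · rw [hzz]; rfl
      · rw [pfn, range_map_succ n (cn u y'), List.replicate_succ]; rfl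
    have hP2 : IsP (3 * n + 2) (fun u => kk w (n + 1) * (∏ i ∈ Finset.range (n + 1), x i) *
        gd (2 * (n + 1)) ex (zz x (cn u y'))) := by
      have h1 := gd_poly (2 * n + 1) (3 * n + 1) ex r (by intro j hj; simp only [ex]; omega)
      convert h1.cmul (kk w (n + 1) * (∏ i ∈ Finset.range (n + 1), x i)) using 3 with u
      rw [hzz]; rfl
    set S1 := (Finset.range (2 * n + 1)).image r with hS1
    set S2 := (Finset.range (n + 1)).image (fun i => w ^ 2 * x i) with hS2
    have hc1 : S1.card = 2 * n + 1 := by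
      rw [hS1, Finset.card_image_of_injOn, Finset.card_range]
      intro a ha b hb hab
      simp only [Finset.coe_range, Set.mem_Iio] at ha hb
      by_contra hne
      exact h3 (a + 1) (by omega) (b + 1) (by omega) (by omega) (congrArg (· ^ 3) hab)
    have hc2 : S2.card = n + 1 := by
      rw [hS2, Finset.card_image_of_injOn, Finset.card_range]
      intro a ha b hb hab
      simp only [Finset.coe_range, Set.mem_Iio] at ha hb
      by_contra hne
      apply hxx a ha b hb hne
      rw [mul_left_cancel₀ (pow_ne_zero 2 w0) hab]
    have hdis : Disjoint S1 S2 := by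
      rw [Finset.disjoint_left]
      intro u hu1 hu2
      simp only [hS1, hS2, Finset.mem_image, Finset.mem_range] at hu1 hu2
      obtain ⟨a, ha, rfl⟩ := hu1
      obtain ⟨b, hb, hab⟩ := hu2
      have hab' : w ^ 2 * x b = zz x y (a + 1) := hab
      by_cases h : a = 2 * b
      · subst h
        rw [hzx] at hab'
        have : (w ^ 2 - 1) * x b = 0 := by linear_combination hab'
        rcases mul_eq_zero.1 this with h | h
        · apply w1; linear_combination w3 - w * h
        · exact hx0 _ hb h
      · apply h3 (a + 1) (by omega) (2 * b + 1) (by omega) (by omega)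
        rw [← hab', hzx]
        linear_combination (w ^ 3 + 1) * x b ^ 3 * w3
    have := IsP.ext hP1 hP2 (S1 ∪ S2) (by rw [Finset.card_union_of_disjoint hdis, hc1, hc2]; omega) ?_ (y 0)
    · have hcy : cn (y 0) y' = y := by funext k; rcases k with _ | k <;> rfl
      simp only [hcy] at this
      exact this
    · intro u hu
      rcases Finset.mem_union.1 hu with hu | hu
      · simp only [hS1, Finset.mem_image, Finset.mem_range] at hu
        obtain ⟨a, ha, hau⟩ := hu
        have hz : ∀ e, gd (2 * (n + 1)) e (zz x (cn u y')) = 0 := by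
          intro e
          rw [hzz]
          exact gd_eq_zero _ _ _ 0 (a + 1) (by omega) (by omega) (by omega) hau.symm
        rw [hz, hz]; ring
      · simp only [hS2, Finset.mem_image, Finset.mem_range] at hu
        obtain ⟨i, hi, hiu⟩ := hu
        apply mainEq_swap w hw n x (cn u y') i hi hd
        apply mainEq_step w hw n
        · simp only [Function.comp, Equiv.swap_apply_left, cn, ← hiu]
          linear_combination (- x i) * w3
        · -- generic position of the remaining variables
          have hex : ∀ k < 2 * n, ∃ m, m < 2 * (n + 1) ∧ (k % 2 = 0 → m = k + 2) ∧
              (k % 2 ≠ 0 → m = 2 * (Equiv.swap 0 i (k / 2 + 1)) + 1) ∧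
              zz (fun k => (x ∘ Equiv.swap 0 i) (k + 1)) (fun k => cn u y' (k + 1)) k = zz x y m := by
            intro k hk
            by_cases hk2 : k % 2 = 0
            · refine ⟨k + 2, by omega, by simp, by simp [hk2], ?_⟩
              have e1 : (k + 2) % 2 = 0 := by omega
              have e2 : (k + 2) / 2 = k / 2 + 1 := by omega
              simp [zz, hk2, e2, hy']; rfl
            · refine ⟨2 * (Equiv.swap 0 i (k / 2 + 1)) + 1, ?_, by simp [hk2], by simp, ?_⟩
              · rw [Equiv.swap_apply_def]; split_ifs <;> omega
              · rw [hzx]; simp [zz, hk2]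
          choose! m hm1 hm2 hm3 hm4 using hex
          apply ih
          · intro a ha
            rw [hm4 a ha]
            exact h0 _ (hm1 a ha)
          · intro a ha b hb hab
            rw [hm4 a ha, hm4 b hb]
            apply h3 _ (hm1 a ha) _ (hm1 b hb)
            have i1 := hm2 a ha
            have i2 := hm3 a ha
            have i3 := hm2 b hb
            have i4 := hm3 b hb
            intro hmm
            by_cases ha2 : a % 2 = 0
            · by_cases hb2 : b % 2 = 0
              · have := i1 ha2; have := i3 hb2; omega
              · have := i1 ha2; have := i4 hb2; omega
            · by_cases hb2 : b % 2 = 0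
              · have := i2 ha2; have := i3 hb2; omega
              · have e1 := i2 ha2; have e2 := i4 hb2
                have e3 : Equiv.swap 0 i (a / 2 + 1) = Equiv.swap 0 i (b / 2 + 1) := by omega
                have e4 := (Equiv.swap 0 i).injective e3
                omega
end ASMProof3

noncomputable section ASMProof4
open Classical

/-- Boolean to integer -/
def b2z (b : Bool) : ℤ := if b then 1 else 0

theorem b2z_cases (b : Bool) : b2z b = 0 ∨ b2z b = 1 := by cases b <;> simp [b2z]

/-- partial sums starting from `h` stay in {0,1} and end at 1 -/
def Valid {n : ℕ} (h : ℤ) (r : Fin n → ℤ) : Prop :=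
  (∀ j, h + ∑ j' ∈ Finset.univ.filter (fun j' => j' ≤ j), r j' = 0 ∨
    h + ∑ j' ∈ Finset.univ.filter (fun j' => j' ≤ j), r j' = 1) ∧ h + ∑ j, r j = 1

theorem sum_le_zero {n : ℕ} (r : Fin (n + 1) → ℤ) :
    ∑ j' ∈ Finset.univ.filter (fun j' => j' ≤ (0 : Fin (n + 1))), r j' = r 0 := by
  rw [Finset.sum_filter, Fin.sum_univ_succ]
  simp

theorem sum_le_succ {n : ℕ} (r : Fin (n + 1) → ℤ) (j : Fin n) :
    ∑ j' ∈ Finset.univ.filter (fun j' => j' ≤ j.succ), r j' =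
      r 0 + ∑ j' ∈ Finset.univ.filter (fun j' => j' ≤ j), r j'.succ := by
  rw [Finset.sum_filter, Fin.sum_univ_succ, Finset.sum_filter]
  simp

theorem valid_succ {n : ℕ} (h : ℤ) (r : Fin (n + 1) → ℤ) :
    Valid h r ↔ (h + r 0 = 0 ∨ h + r 0 = 1) ∧ Valid (h + r 0) (fun j => r j.succ) := by
  simp only [Valid, Fin.forall_fin_succ, sum_le_zero, sum_le_succ, Fin.sum_univ_succ, add_assoc, and_assoc]

/-- row between states -/
def diffRow {n : ℕ} (s t : Fin n → Bool) : Fin n → ℤ := fun j => b2z (t j) - b2z (s j)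

theorem sum_states {n : ℕ} (g : (Fin (n + 1) → Bool) → ℂ) :
    ∑ t, g t = (∑ t : Fin n → Bool, g (Fin.cons true t)) + ∑ t : Fin n → Bool, g (Fin.cons false t) := by
  rw [← (Fin.consEquiv (fun _ : Fin (n + 1) => Bool)).sum_comp, Fintype.sum_prod_type, Fintype.sum_bool]
  rfl

theorem rowOp_one (w : ℂ) : ∀ (n : ℕ) (h : Bool) (f : List Bool → ℂ) (s : Fin n → Bool),
    rowOp w 1 (List.replicate n 1) h f (List.ofFn s) = (w - w ^ 2) ^ n *
      ∑ t : Fin n → Bool, if Valid (b2z h) (diffRow s t) then f (List.ofFn t) else 0 := by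
  intro n
  induction n with
  | zero =>
    intro h f s
    cases h <;> simp [rowOp, Valid, b2z]
  | succ n ih =>
    intro h f s
    obtain ⟨b, s, rfl⟩ : ∃ b s', s = Fin.cons b s' := ⟨s 0, Fin.tail s, (Fin.cons_self_tail s).symm⟩
    have hd : ∀ b' (t : Fin n → Bool), (fun j : Fin n => diffRow (Fin.cons b s : Fin (n + 1) → Bool) (Fin.cons b' t) j.succ)
        = diffRow s t := by intro b' t; funext j; simp [diffRow]
    have hd0 : ∀ b' (t : Fin n → Bool), diffRow (Fin.cons b s : Fin (n + 1) → Bool) (Fin.cons b' t) 0 = b2z b' - b2z b := by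
      intro b' t; simp [diffRow]
    rw [sum_states]
    simp only [valid_succ, hd, hd0]
    simp only [List.ofFn_cons, List.replicate_succ]
    cases h <;> cases b <;> simp only [rowOp, ih] <;> simp [b2z, wA, wB, wC] <;> ring

/-- column condition and row condition for m-by-n arrays, starting from the column state `s` -/
def Cond {m n : ℕ} (s : Fin n → Bool) (A : Fin m → Fin n → ℤ) : Prop :=
  (∀ i, Valid 0 (A i)) ∧ ∀ j, Valid (b2z (s j)) (fun i => A i j)

theorem cond_succ {m n : ℕ} (s : Fin n → Bool) (A : Fin (m + 1) → Fin n → ℤ) :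
    Cond s A ↔ ∃ t, A 0 = diffRow s t ∧ Valid 0 (diffRow s t) ∧ Cond t (fun i => A i.succ) := by
  simp only [Cond, Fin.forall_fin_succ, valid_succ (n := m)]
  constructor
  · rintro ⟨⟨h1, h2⟩, h3⟩
    have ht : A 0 = diffRow s (fun j => decide (b2z (s j) + A 0 j = 1)) := by
      funext j
      rcases (h3 j).1 with h | h
      · have hd : decide (b2z (s j) + A 0 j = 1) = false := by simp [h]
        have hb : b2z false = 0 := rfl
        simp only [diffRow, hd, hb]
        linarith
      · have hd : decide (b2z (s j) + A 0 j = 1) = true := by simp [h]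
        have hb : b2z true = 1 := rfl
        simp only [diffRow, hd, hb]
        linarith
    refine ⟨_, ht, ht ▸ h1, h2, ?_⟩
    intro j
    have h4 := (h3 j).2
    rcases (h3 j).1 with h | h
    · rw [h] at h4 ⊢; simpa [b2z] using h4
    · rw [h] at h4 ⊢; simpa [b2z] using h4
  · rintro ⟨t, h0, h1, h2, h3⟩
    refine ⟨⟨h0 ▸ h1, h2⟩, ?_⟩
    intro j
    have h5 : b2z (s j) + A 0 j = b2z (t j) := by rw [h0]; simp [diffRow]
    rw [h5]
    exact ⟨b2z_cases _, h3 j⟩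

theorem diffRow_inj {n : ℕ} (s t t' : Fin n → Bool) (h : diffRow s t = diffRow s t') : t = t' := by
  funext j
  have := congrFun h j
  simp only [diffRow] at this
  have h2 : b2z (t j) = b2z (t' j) := by linarith
  cases ht : t j <;> cases ht' : t' j <;> simp [ht, ht', b2z] at h2 ⊢

/-- peel off the first row -/
def condEquiv {m n : ℕ} (s : Fin n → Bool) :
    (Σ t : Fin n → Bool, {A : Fin m → Fin n → ℤ // Valid 0 (diffRow s t) ∧ Cond t A}) ≃
      {A : Fin (m + 1) → Fin n → ℤ // Cond s A} := by
  refine Equiv.ofBijective (fun p => ⟨Fin.cons (diffRow s p.1) p.2.1, ?_⟩) ⟨?_, ?_⟩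
  · rw [cond_succ]
    exact ⟨p.1, by simp, p.2.2.1, by simpa using p.2.2.2⟩
  · rintro ⟨t, A, hA⟩ ⟨t', A', hA'⟩ h
    simp only [Subtype.mk.injEq, Fin.cons_inj] at h
    obtain ⟨h1, h2⟩ := h
    obtain rfl := diffRow_inj s t t' h1
    subst h2
    rfl
  · rintro ⟨A, hA⟩
    obtain ⟨t, h1, h2, h3⟩ := (cond_succ s A).1 hA
    refine ⟨⟨t, fun i => A i.succ, h2, h3⟩, ?_⟩
    simp only [Subtype.mk.injEq]
    rw [← h1]
    exact Fin.cons_self_tail A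

theorem pf_one (w : ℂ) (n : ℕ) : ∀ (m : ℕ) (s : Fin n → Bool),
    Finite {A : Fin m → Fin n → ℤ // Cond s A} ∧
    pf w (List.replicate n 1) (List.replicate m 1) (List.ofFn s) =
      (w - w ^ 2) ^ (m * n) * (Nat.card {A : Fin m → Fin n → ℤ // Cond s A} : ℂ) := by
  intro m
  induction m with
  | zero =>
    intro s
    refine ⟨inferInstance, ?_⟩
    simp only [List.replicate_zero, pf, zero_mul, pow_zero, one_mul]
    by_cases h : ∀ j, s j = true
    · have : Unique {A : Fin 0 → Fin n → ℤ // Cond s A} :=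
        { default := ⟨fun i => i.elim0, by
            refine ⟨fun i => i.elim0, fun j => ⟨fun i => i.elim0, by simp [h, b2z]⟩⟩⟩
          uniq := fun a => Subsingleton.elim _ _ }
      rw [Nat.card_unique]
      simp [h]
    · have : IsEmpty {A : Fin 0 → Fin n → ℤ // Cond s A} := by
        constructor
        rintro ⟨A, h1, h2⟩
        apply h
        intro j
        have := (h2 j).2
        simp [b2z] at this
        exact this
      rw [Nat.card_of_isEmpty]
      have h' : ∃ j, s j = false := by simpa using h
      simp [h']
  | succ m ih =>
    intro s
    have hfin : ∀ t : Fin n → Bool, Finite {A : Fin m → Fin n → ℤ // Valid 0 (diffRow s t) ∧ Cond t A} := by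
      intro t
      have := (ih t).1
      exact Finite.of_injective (fun A => (⟨A.1, A.2.2⟩ : {A : Fin m → Fin n → ℤ // Cond t A}))
        (fun a b hab => Subtype.ext (congrArg (fun z => z.1) hab))
    refine ⟨Finite.of_equiv _ (condEquiv s), ?_⟩
    rw [← Nat.card_congr (condEquiv s), Nat.card_sigma, List.replicate_succ, pf, rowOp_one]
    push_cast
    rw [Finset.mul_sum, Finset.mul_sum]
    apply Finset.sum_congr rfl
    intro t _
    rw [(ih t).2]
    by_cases hv : Valid 0 (diffRow s t)
    · simp only [hv, true_and]
      have : Valid (b2z false) (diffRow s t) := hv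
      rw [if_pos this]
      ring
    · have : ¬ Valid (b2z false) (diffRow s t) := hv
      rw [if_neg this]
      simp [hv]

theorem isASM_iff {n : ℕ} (A : Matrix (Fin n) (Fin n) ℤ) :
    IsASM A ↔ Cond (fun _ => false) (fun i j => A i j) := by
  constructor
  · rintro ⟨_, h1, h2, h3, h4⟩
    refine ⟨fun i => ⟨fun j => ?_, ?_⟩, fun j => ⟨fun i => ?_, ?_⟩⟩
    · simpa using h1 i j
    · simpa using h3 i
    · simpa [b2z] using h2 i j
    · simpa [b2z] using h4 j
  · rintro ⟨h1, h2⟩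
    have g1 : ∀ i j, ∑ j' ∈ Finset.univ.filter (fun j' => j' ≤ j), A i j' = 0 ∨
          ∑ j' ∈ Finset.univ.filter (fun j' => j' ≤ j), A i j' = 1 := by
      intro i j; simpa using (h1 i).1 j
    refine ⟨?_, g1, ?_, ?_, ?_⟩
    · intro i j
      rcases n with _ | n
      · exact j.elim0
      · induction j using Fin.cases with
        | zero => have := g1 i 0; rw [sum_le_zero] at this; exact Or.inr this
        | succ j =>
          have e1 := g1 i j.succ
          have e2 := g1 i j.castSucc
          have e3 : ∑ j' ∈ Finset.univ.filter (fun j' => j' ≤ j.succ), A i j' =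
              A i j.succ + ∑ j' ∈ Finset.univ.filter (fun j' => j' ≤ j.castSucc), A i j' := by
            rw [← Finset.sum_insert (by simp [Fin.le_def])]
            apply Finset.sum_congr _ (fun _ _ => rfl)
            ext k
            simp [Fin.le_def, Fin.ext_iff]
            omega
          omega
    · intro i j; simpa [b2z] using (h2 j).1 i
    · intro i; simpa using (h1 i).2
    · intro j; simpa [b2z] using (h2 j).2

theorem pfn_one (w : ℂ) (n : ℕ) : pfn w n (fun _ => 1) (fun _ => 1) =
    (w - w ^ 2) ^ (n * n) * (Nat.card {A : Matrix (Fin n) (Fin n) ℤ // IsASM A} : ℂ) := by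
  have h := (pf_one w n n (fun _ => false)).2
  have e : Nat.card {A : Matrix (Fin n) (Fin n) ℤ // IsASM A} =
      Nat.card {A : Fin n → Fin n → ℤ // Cond (fun _ => false) A} :=
    Nat.card_congr (Equiv.subtypeEquivRight (fun A => isASM_iff A))
  rw [e, ← h, pfn]
  simp [List.ofFn_const]
end ASMProof4

noncomputable section ASMProof5

theorem rowOp_cont (w : ℂ) (x : ℝ → ℂ) (hx : Continuous x) (y : ℕ → ℝ → ℂ) (hy : ∀ k, Continuous (y k))
    (l : List ℕ) : ∀ (h : Bool) (f : ℝ → List Bool → ℂ) (_ : ∀ s, Continuous (fun t => f t s))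
    (s : List Bool), Continuous (fun t => rowOp w (x t) (l.map (fun k => y k t)) h (f t) s) := by
  induction l with
  | nil =>
    intro h f hf s
    cases h
    · simpa [rowOp] using continuous_const
    · simpa [rowOp] using hf []
  | cons k l ih =>
    intro h f hf s
    have h1 := fun h s => ih h (fun u t => f u (false :: t)) (fun t => hf _) s
    have h2 := fun h s => ih h (fun u t => f u (true :: t)) (fun t => hf _) s
    have hyk := hy k
    have a1 : Continuous (fun t => wA w (x t) (y k t)) := by unfold wA; fun_prop
    have a2 : Continuous (fun t => wB w (x t) (y k t)) := by unfold wB; fun_prop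
    have a3 : Continuous (fun t => wC w (x t)) := by unfold wC; fun_prop
    have a4 : Continuous (fun t => wC w (y k t)) := by unfold wC; fun_prop
    rcases s with _ | ⟨b, s⟩
    · simpa [rowOp] using continuous_const
    · cases h <;> cases b <;> simp only [rowOp, List.map_cons]
      · exact (a1.mul (h1 _ _)).add (a3.mul (h2 _ _))
      · exact a2.mul (h2 _ _)
      · exact a2.mul (h1 _ _)
      · exact (a1.mul (h2 _ _)).add (a4.mul (h1 _ _))

theorem pf_cont (w : ℂ) (x : ℕ → ℝ → ℂ) (hx : ∀ k, Continuous (x k)) (y : ℕ → ℝ → ℂ)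
    (hy : ∀ k, Continuous (y k)) (l l' : List ℕ) : ∀ s : List Bool,
    Continuous (fun t => pf w (l.map (fun k => y k t)) (l'.map (fun k => x k t)) s) := by
  induction l' with
  | nil => intro s; simpa [pf] using continuous_const
  | cons k l' ih =>
    intro s
    exact rowOp_cont w (x k) (hx k) y hy l false _ ih s

/-- geometric sums -/
def geo (t : ℂ) (a : ℕ) : ℂ := ∑ k ∈ Finset.range a, t ^ k

theorem prod_Ioi {N : ℕ} (F : ℕ → ℕ → ℂ) : ∏ i : Fin N, ∏ j ∈ Finset.Ioi i, F i j =
    ∏ j ∈ Finset.range N, ∏ i ∈ Finset.range j, F i j := by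
  have h1 : ∀ i : Fin N, ∏ j ∈ Finset.Ioi i, F i j = ∏ j : Fin N, if (i : ℕ) < j then F i j else 1 := by
    intro i
    rw [← Finset.prod_filter]
    apply Finset.prod_congr _ (fun _ _ => rfl)
    ext j; simp
  simp only [h1]
  rw [Finset.prod_comm, Finset.prod_range]
  apply Finset.prod_congr rfl
  intro j _
  rw [← Finset.prod_range (fun i => if i < (j : ℕ) then F i j else 1), ← Finset.prod_filter]
  apply Finset.prod_congr _ (fun _ _ => rfl)
  ext i
  simp only [Finset.mem_filter, Finset.mem_range]
  have := j.2
  omega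

/-- product of differences -/
def dp (N : ℕ) (g : ℕ → ℂ) : ℂ := ∏ j ∈ Finset.range N, ∏ i ∈ Finset.range j, (g j - g i)

theorem gd_geom (N : ℕ) (e : ℕ → ℕ) (t : ℂ) : gd N e (fun k => t ^ k) = dp N (fun j => t ^ e j) := by
  rw [dp, ← prod_Ioi (fun i j => t ^ e j - t ^ e i), gd, ← Matrix.det_transpose]
  rw [← Matrix.det_vandermonde (fun i : Fin N => t ^ e i)]
  congr 1
  ext i j
  simp only [Matrix.transpose_apply, Matrix.of_apply, Matrix.vandermonde_apply, ← pow_mul, mul_comm]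

theorem dp_geo (N : ℕ) (e : ℕ → ℕ) (t : ℂ) : dp N (fun j => t ^ e j) =
    (∏ j ∈ Finset.range N, ∏ _i ∈ Finset.range j, (t - 1)) * dp N (fun j => geo t (e j)) := by
  rw [dp, dp, ← Finset.prod_mul_distrib]
  apply Finset.prod_congr rfl
  intro j _
  rw [← Finset.prod_mul_distrib]
  apply Finset.prod_congr rfl
  intro i _
  have h := fun a => mul_geom_sum t a
  simp only [geo, mul_sub, h]
  ring

theorem geo_cont (a : ℕ) : Continuous (fun t : ℝ => geo (t : ℂ) a) := by
  unfold geo; fun_prop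

theorem dp_cont (N : ℕ) (e : ℕ → ℕ) : Continuous (fun t : ℝ => dp N (fun j => geo (t : ℂ) (e j))) := by
  unfold dp
  refine continuous_finsetProd _ (fun j _ => continuous_finsetProd _ (fun i _ => ?_))
  exact (geo_cont _).sub (geo_cont _)

theorem limit_eq (w : ℂ) (hw : w ^ 2 + w + 1 = 0) (n : ℕ) :
    dp (2 * n) (fun j => (j : ℂ)) *
      ((w - w ^ 2) ^ (n * n) * (Nat.card {A : Matrix (Fin n) (Fin n) ℤ // IsASM A} : ℂ)) =
    kk w n * dp (2 * n) (fun j => (ex j : ℂ)) := by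
  set x : ℕ → ℝ → ℂ := fun k t => (t : ℂ) ^ (2 * k + 1) with hx
  set y : ℕ → ℝ → ℂ := fun k t => (t : ℂ) ^ (2 * k) with hy
  have hxc : ∀ k, Continuous (x k) := by intro k; simp only [hx]; fun_prop
  have hyc : ∀ k, Continuous (y k) := by intro k; simp only [hy]; fun_prop
  have hzz : ∀ t : ℝ, zz (fun k => x k t) (fun k => y k t) = fun k => (t : ℂ) ^ k := by
    intro t
    funext k
    simp only [zz, hx, hy]
    split_ifs with h
    · congr 1; omega
    · congr 1; omega
  set f : ℝ → ℂ := fun t => dp (2 * n) (fun j => geo (t : ℂ) (id j)) *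
    pfn w n (fun k => x k t) (fun k => y k t) with hf
  set g : ℝ → ℂ := fun t => kk w n * (∏ i ∈ Finset.range n, x i t) *
    dp (2 * n) (fun j => geo (t : ℂ) (ex j)) with hg
  have hfc : Continuous f := (dp_cont _ _).mul (pf_cont w x hxc y hyc _ _ _)
  have hgc : Continuous g := (continuous_const.mul (continuous_finsetProd _ (fun i _ => hxc i))).mul (dp_cont _ _)
  have heq : Set.EqOn f g (Set.Ioi 1) := by
    intro t ht
    have ht1 : (1 : ℝ) < t := ht
    have ht0 : (t : ℂ) ≠ 0 := by exact_mod_cast (by linarith : t ≠ 0)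
    have htt : (t : ℂ) - 1 ≠ 0 := by
      rw [sub_ne_zero]; exact_mod_cast (by linarith [ht1] : t ≠ 1)
    have hm := mainEq w hw n (fun k => x k t) (fun k => y k t)
      (by intro a _; rw [hzz]; exact pow_ne_zero _ ht0)
      (by
        intro a _ b _ hab
        rw [hzz]
        simp only [← pow_mul]
        intro h
        have h' : t ^ (a * 3) = t ^ (b * 3) := by exact_mod_cast h
        have := pow_right_injective₀ (by linarith) ht1.ne' h'
        omega)
    unfold MainEq at hm
    rw [hzz, gd_geom, gd_geom, dp_geo, dp_geo] at hm
    have hne : (∏ j ∈ Finset.range (2 * n), ∏ _i ∈ Finset.range j, ((t : ℂ) - 1)) ≠ 0 :=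
      Finset.prod_ne_zero_iff.2 (fun j _ => Finset.prod_ne_zero_iff.2 (fun i _ => htt))
    apply mul_left_cancel₀ hne
    simp only [hf, hg]
    linear_combination hm
  have h1 : f 1 = g 1 := by
    have := heq.closure hfc hgc
    apply this
    rw [closure_Ioi]
    exact Set.self_mem_Ici
  simp only [hf, hg, hx, hy, Complex.ofReal_one, one_pow, pfn_one] at h1
  simpa [geo] using h1

theorem dp_succ (N : ℕ) (g : ℕ → ℂ) : dp (N + 1) g = dp N g * ∏ i ∈ Finset.range N, (g N - g i) := by
  rw [dp, Finset.prod_range_succ]; rfl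

theorem prod_fact (j : ℕ) : ∏ i ∈ Finset.range j, ((j : ℂ) - i) = (j.factorial : ℂ) := by
  induction j with
  | zero => simp
  | succ j ih =>
    rw [Finset.prod_range_succ', Nat.factorial_succ]
    push_cast
    rw [← ih]
    simp only [add_sub_add_right_eq_sub]
    ring

theorem ex_add_two (j : ℕ) : ex (j + 2) = ex j + 3 := by simp only [ex]; omega

theorem prod_ex (n : ℕ) :
    (∏ i ∈ Finset.range (2 * n), ((ex (2 * n) : ℂ) - ex i)) *
      (∏ i ∈ Finset.range (2 * n + 1), ((ex (2 * n + 1) : ℂ) - ex i)) =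
    3 ^ n * n.factorial * (3 * n + 1).factorial := by
  induction n with
  | zero => simp [ex]
  | succ n ih =>
    have e0 : ex (2 * n) = 3 * n := by simp only [ex]; omega
    have e1 : ex (2 * n + 1) = 3 * n + 1 := by simp only [ex]; omega
    have z0 : ex 0 = 0 := rfl
    have z1 : ex 1 = 1 := rfl
    have s1 : 2 * (n + 1) = 2 * n + 2 := by ring
    have s2 : 2 * n + 2 + 1 = (2 * n + 1) + 2 := by ring
    have s3 : 3 * (n + 1) + 1 = 3 * n + 1 + 1 + 1 + 1 := by ring
    have key : ∀ m, ∏ i ∈ Finset.range (m + 2), ((ex (m + 2) : ℂ) - ex i) =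
        (∏ i ∈ Finset.range m, ((ex m : ℂ) - ex i)) * ((ex m + 2) * (ex m + 3)) := by
      intro m
      rw [Finset.prod_range_succ', Finset.prod_range_succ']
      simp only [add_assoc, ex_add_two, z0, z1, Nat.reduceAdd, zero_add]
      push_cast
      simp only [add_sub_add_right_eq_sub]
      ring
    have hf : (3 * n + 1 + 1 + 1 + 1).factorial =
        (3 * n + 1 + 1 + 1) * ((3 * n + 1 + 1) * (3 * n + 1).factorial) * (3 * n + 1 + 1 + 1 + 1) := by
      rw [Nat.factorial_succ, Nat.factorial_succ, Nat.factorial_succ]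
      ring
    rw [s1, s2, key, key, s3, hf, Nat.factorial_succ n]
    rw [mul_mul_mul_comm, ih, e0, e1]
    push_cast
    ring

theorem prod_fact_shift (n : ℕ) :
    (∏ k ∈ Finset.range (n + 1), (n + 1 + k).factorial) * n.factorial =
      (∏ k ∈ Finset.range n, (n + k).factorial) * ((2 * n).factorial * (2 * n + 1).factorial) := by
  have h : (∏ k ∈ Finset.range (n + 1), (n + 1 + k).factorial) * n.factorial =
      ∏ k ∈ Finset.range (n + 2), (n + k).factorial := by
    rw [Finset.prod_range_succ' (fun k => (n + k).factorial)]
    congr 1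
    apply Finset.prod_congr rfl
    intro k _
    congr 1; ring
  rw [h, Finset.prod_range_succ, Finset.prod_range_succ, mul_assoc]
  congr 3 <;> ring

theorem arith (w : ℂ) (hw : w ^ 2 + w + 1 = 0) (n : ℕ) :
    kk w n * dp (2 * n) (fun j => (ex j : ℂ)) * ((∏ k ∈ Finset.range n, (n + k).factorial : ℕ) : ℂ) =
      dp (2 * n) (fun j => (j : ℂ)) * (w - w ^ 2) ^ (n * n) *
        ((∏ k ∈ Finset.range n, (3 * k + 1).factorial : ℕ) : ℂ) := by
  induction n with
  | zero => simp [kk, dp]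
  | succ n ih =>
    have hn : (n.factorial : ℂ) ≠ 0 := by exact_mod_cast n.factorial_ne_zero
    apply mul_left_cancel₀ hn
    have hs : ((∏ k ∈ Finset.range (n + 1), (n + 1 + k).factorial : ℕ) : ℂ) * n.factorial =
      ((∏ k ∈ Finset.range n, (n + k).factorial : ℕ) : ℂ) * ((2 * n).factorial * (2 * n + 1).factorial) := by
      exact_mod_cast prod_fact_shift n
    have hT := prod_ex n
    have hc : dp (2 * (n + 1)) (fun j => (j : ℂ)) =
        dp (2 * n) (fun j => (j : ℂ)) * ((2 * n).factorial * (2 * n + 1).factorial) := by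
      rw [show 2 * (n + 1) = 2 * n + 1 + 1 by ring, dp_succ, dp_succ, prod_fact, prod_fact]
      ring
    have hL : dp (2 * (n + 1)) (fun j => (ex j : ℂ)) =
        dp (2 * n) (fun j => (ex j : ℂ)) * (3 ^ n * n.factorial * (3 * n + 1).factorial) := by
      rw [show 2 * (n + 1) = 2 * n + 1 + 1 by ring, dp_succ, dp_succ, ← hT]
      ring
    have hp : (w - w ^ 2) ^ ((n + 1) * (n + 1)) = (w - w ^ 2) ^ (n * n) * ((w - w ^ 2) * ((-1) ^ n * 3 ^ n)) := by
      have h3 : (w - w ^ 2) ^ 2 = (-1) * 3 := by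
        linear_combination (w ^ 2 - 3 * w + 3) * hw
      rw [← mul_pow, ← h3]
      generalize w - w ^ 2 = c
      ring
    have hP : ((∏ k ∈ Finset.range (n + 1), (3 * k + 1).factorial : ℕ) : ℂ) =
        ((∏ k ∈ Finset.range n, (3 * k + 1).factorial : ℕ) : ℂ) * ((3 * n + 1).factorial : ℂ) := by
      rw [Finset.prod_range_succ]; push_cast; ring
    rw [hc, hL, hp, hP, kk]
    generalize ((∏ k ∈ Finset.range (n + 1), (n + 1 + k).factorial : ℕ) : ℂ) = F' at *
    generalize ((∏ k ∈ Finset.range n, (n + k).factorial : ℕ) : ℂ) = F at *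
    generalize ((∏ k ∈ Finset.range n, (3 * k + 1).factorial : ℕ) : ℂ) = P at *
    linear_combination ((w - w ^ 2) * (-1) ^ n * kk w n * dp (2 * n) (fun j => (ex j : ℂ)) *
      (3 ^ n * n.factorial * (3 * n + 1).factorial)) * hs +
      ((w - w ^ 2) * (-1) ^ n * (3 ^ n * n.factorial * (3 * n + 1).factorial) *
        ((2 * n).factorial * (2 * n + 1).factorial)) * ih
end ASMProof5

/-- The number of `n × n` alternating-sign matrices equals
`∏_{k=0}^{n-1} (3k+1)! / (n+k)!`. -/
theorem asm_count (n : ℕ) :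
    Nat.card {A : Matrix (Fin n) (Fin n) ℤ // IsASM A} *
      ∏ k ∈ Finset.range n, (n + k).factorial =
    ∏ k ∈ Finset.range n, (3 * k + 1).factorial := by
  obtain ⟨w, hw⟩ : ∃ w : ℂ, w ^ 2 + w + 1 = 0 := by
    obtain ⟨w, hw⟩ := IsAlgClosed.exists_pow_nat_eq (-3 : ℂ) (n := 2) (by norm_num)
    exact ⟨(-1 + w) / 2, by linear_combination hw / 4⟩
  have h1 := limit_eq w hw n
  have h2 := arith w hw n
  have hc : dp (2 * n) (fun j => (j : ℂ)) ≠ 0 := by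
    unfold dp
    simp only [prod_fact]
    exact Finset.prod_ne_zero_iff.2 (fun j _ => by exact_mod_cast j.factorial_ne_zero)
  have hd : (w - w ^ 2) ^ (n * n) ≠ 0 := by
    apply pow_ne_zero
    intro h
    have h3 : (w - w ^ 2) ^ 2 = -3 := by
      linear_combination (w ^ 2 - 3 * w + 3) * hw
    rw [h] at h3
    norm_num at h3
  have h3 : ((Nat.card {A : Matrix (Fin n) (Fin n) ℤ // IsASM A} *
      ∏ k ∈ Finset.range n, (n + k).factorial : ℕ) : ℂ) =
      ((∏ k ∈ Finset.range n, (3 * k + 1).factorial : ℕ) : ℂ) := by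
    apply mul_left_cancel₀ (mul_ne_zero hc hd)
    rw [← h2, ← h1, Nat.cast_mul]
    ring
  exact_mod_cast h3
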